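/- arXiv:1612.07122 — 2 statements merged into one kernel-verified Lean document; each statement's English description precedes it below -/
import Mathlib

section
/- Fix θ ∈ [0,1), ε > 0, ν > 0 and constants 0 < a ≤ b. For each N, let K = K(N) be a natural number with a·N^θ ≤ K ≤ b·N^θ, let T = T(N) be a number of tests with T ≤ (1−ε)·(1/ln 2)·K·log₂ N, and run the near-constant column weight design with per-item weight L = ⌊ν·T/K⌋. Then the success probability of the COMP algorithm tends to 0 as N → ∞. -/
open Filter

/-- Test `t` is positive: it contains at least one defective item (items are placed in tests
via their list of chosen tests `X i : Fin L → Fin T`). -/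
def IsPositive {N T L : ℕ} (S : Finset (Fin N)) (X : Fin N → Fin L → Fin T) (t : Fin T) : Prop :=
  ∃ i ∈ S, ∃ l, X i l = t

/-- COMP succeeds iff the set of items appearing in no negative test (equivalently, all of whose
tests are positive) equals the defective set `S`. -/
def CompSucceeds {N T L : ℕ} (S : Finset (Fin N)) (X : Fin N → Fin L → Fin T) : Prop :=
  {i : Fin N | ∀ l : Fin L, IsPositive S X (X i l)} = (S : Set (Fin N))

/-- Success probability of COMP under the near-constant column weight design: the defective set
is uniform over the `K`-subsets of the `N` items, and independently each item picks `L` tests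
uniformly at random with replacement from the `T` tests. -/
noncomputable def compSuccessProb (N K T L : ℕ) : ℝ :=
  (Nat.card {ω : {S : Finset (Fin N) // S.card = K} × (Fin N → Fin L → Fin T) //
      CompSucceeds ω.1.1 ω.2} : ℝ) /
    (Nat.card ({S : Finset (Fin N) // S.card = K} × (Fin N → Fin L → Fin T)) : ℝ)

/-- The tests hit by the choices `f`. -/
noncomputable def hitTests {ι : Type*} {T L : ℕ} (f : ι → Fin L → Fin T) : Finset (Fin T) :=
  open Classical in Finset.univ.filter fun t => ∃ i l, f i l = t

/-- The tests missed by the choices `f`. -/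
noncomputable def missedTests {ι : Type*} {T L : ℕ} (f : ι → Fin L → Fin T) : Finset (Fin T) :=
  open Classical in Finset.univ.filter fun t => ∀ i l, f i l ≠ t

theorem mem_hitTests {ι : Type*} {T L : ℕ} (f : ι → Fin L → Fin T) (t : Fin T) :
    t ∈ hitTests f ↔ ∃ i l, f i l = t := by
  simp [hitTests]

theorem card_hitTests_add_card_missedTests {ι : Type*} {T L : ℕ} (f : ι → Fin L → Fin T) :
    (hitTests f).card + (missedTests f).card = T := by
  classical
  have h := Finset.card_filter_add_card_filter_not (s := (Finset.univ : Finset (Fin T)))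
    (fun t => ∃ i l, f i l = t)
  simp only [not_exists, Finset.card_univ, Fintype.card_fin] at h
  unfold hitTests missedTests
  convert h

theorem Fintype.card_pi_pi_mem {ι : Type*} [Fintype ι] {T L : ℕ} (A : Finset (Fin T)) :
    Nat.card {f : ι → Fin L → Fin T // ∀ i l, f i l ∈ A} = A.card ^ (Fintype.card ι * L) := by
  classical
  have h : Nat.card {f : ι → Fin L → Fin T // ∀ i l, f i l ∈ A} =
      (Fintype.piFinset fun _ : ι => Fintype.piFinset fun _ : Fin L => A).card := by
    rw [Nat.card_eq_fintype_card, Fintype.card_subtype]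
    congr 1
    ext f
    simp [Fintype.mem_piFinset]
  rw [h]
  simp [Fintype.card_piFinset, ← pow_mul, mul_comm]

theorem Fintype.card_filter_forall_ne {ι : Type*} [Fintype ι] {T L : ℕ} (t : Fin T) :
    open Classical in
    (Finset.univ.filter fun f : ι → Fin L → Fin T => ∀ i l, f i l ≠ t).card =
      (T - 1) ^ (Fintype.card ι * L) := by
  classical
  have h := Fintype.card_pi_pi_mem (ι := ι) (L := L) ({t}ᶜ : Finset (Fin T))
  rw [Nat.card_eq_fintype_card, Fintype.card_subtype] at h
  simpa [Finset.card_compl] using h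

theorem Fintype.card_filter_forall_ne_and_ne {ι : Type*} [Fintype ι] {T L : ℕ} {s t : Fin T}
    (hst : s ≠ t) :
    open Classical in
    (Finset.univ.filter fun f : ι → Fin L → Fin T =>
      (∀ i l, f i l ≠ s) ∧ ∀ i l, f i l ≠ t).card = (T - 2) ^ (Fintype.card ι * L) := by
  classical
  have h := Fintype.card_pi_pi_mem (ι := ι) (L := L) ({s, t}ᶜ : Finset (Fin T))
  rw [Nat.card_eq_fintype_card, Fintype.card_subtype] at h
  rw [Finset.card_compl, Finset.card_pair hst, Fintype.card_fin] at h
  rw [← h]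
  congr 1
  ext f
  simp [forall_and]

theorem sum_card_missedTests {ι : Type*} [Fintype ι] [DecidableEq ι] (T L : ℕ) :
    ∑ f : ι → Fin L → Fin T, (missedTests f).card = T * (T - 1) ^ (Fintype.card ι * L) := by
  classical
  simp only [missedTests, Finset.card_filter]
  rw [Finset.sum_comm]
  have h := fun t : Fin T => Fintype.card_filter_forall_ne (ι := ι) (L := L) t
  calc _ = ∑ t : Fin T, (T - 1) ^ (Fintype.card ι * L) :=
        Finset.sum_congr rfl fun t _ => by rw [← h t, Finset.card_filter]; congr!
    _ = _ := by simp

theorem sum_card_missedTests_sq_le {ι : Type*} [Fintype ι] [DecidableEq ι] (T L : ℕ) :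
    ∑ f : ι → Fin L → Fin T, (missedTests f).card ^ 2 ≤
      T * (T - 1) ^ (Fintype.card ι * L) + T ^ 2 * (T - 2) ^ (Fintype.card ι * L) := by
  classical
  have hsq : ∀ f : ι → Fin L → Fin T, (missedTests f).card ^ 2 =
      ∑ s : Fin T, ∑ t : Fin T,
        if (∀ i l, f i l ≠ s) ∧ ∀ i l, f i l ≠ t then 1 else 0 := by
    intro f
    rw [sq, missedTests, Finset.card_filter, Finset.sum_mul_sum]
    refine Finset.sum_congr rfl fun s _ => Finset.sum_congr rfl fun t _ => ?_
    split_ifs <;> simp_all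
  simp_rw [hsq]
  rw [Finset.sum_comm]
  have hpair : ∀ s t : Fin T, (∑ f : ι → Fin L → Fin T,
      if (∀ i l, f i l ≠ s) ∧ ∀ i l, f i l ≠ t then 1 else 0) ≤
      (if s = t then (T - 1) ^ (Fintype.card ι * L) else 0) +
        (T - 2) ^ (Fintype.card ι * L) := by
    intro s t
    rw [← Finset.card_filter]
    by_cases hst : s = t
    · subst hst
      simp only [and_self, if_true]
      refine le_trans (le_of_eq ?_) (Nat.le_add_right _ _)
      rw [← Fintype.card_filter_forall_ne (ι := ι) (L := L) s]
      congr!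
    · rw [if_neg hst, zero_add, ← Fintype.card_filter_forall_ne_and_ne (ι := ι) (L := L) hst]
      refine le_of_eq ?_
      congr!
  calc _ = ∑ s : Fin T, ∑ t : Fin T, ∑ f : ι → Fin L → Fin T,
        (if (∀ i l, f i l ≠ s) ∧ ∀ i l, f i l ≠ t then 1 else 0) :=
        Finset.sum_congr rfl fun s _ => Finset.sum_comm
    _ ≤ ∑ s : Fin T, ∑ t : Fin T, ((if s = t then (T - 1) ^ (Fintype.card ι * L) else 0) +
        (T - 2) ^ (Fintype.card ι * L)) :=
        Finset.sum_le_sum fun s _ => Finset.sum_le_sum fun t _ => hpair s t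
    _ = _ := by
        simp only [Finset.sum_add_distrib, Finset.sum_ite_eq, Finset.mem_univ, if_true,
          Finset.sum_const, Finset.card_univ, Fintype.card_fin, smul_eq_mul]
        ring

theorem sum_card_missedTests_sub_sq_le {ι : Type*} [Fintype ι] [DecidableEq ι] {T : ℕ} (L : ℕ)
    (hT : 1 ≤ T) :
    ∑ f : ι → Fin L → Fin T,
        ((missedTests f).card - T * (((T : ℝ) - 1) / T) ^ (Fintype.card ι * L)) ^ 2 ≤
      (T : ℝ) ^ (Fintype.card ι * L) * T := by
  set n := Fintype.card ι * L with hn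
  set q : ℝ := (((T : ℝ) - 1) / T) ^ n with hq
  have hT0 : (0 : ℝ) < T := by exact_mod_cast hT
  have hT1 : (1 : ℝ) ≤ T := by exact_mod_cast hT
  have h1 : ∑ f : ι → Fin L → Fin T, ((missedTests f).card : ℝ) = T * (q * (T : ℝ) ^ n) := by
    have h := sum_card_missedTests (ι := ι) T L
    rw [← hn] at h
    rw [← Nat.cast_sum, h, hq, div_pow, div_mul_cancel₀ _ (by positivity)]
    push_cast [Nat.cast_sub hT]
    ring
  have h2 : ∑ f : ι → Fin L → Fin T, ((missedTests f).card : ℝ) ^ 2 ≤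
      T * (q * (T : ℝ) ^ n) + (T : ℝ) ^ 2 * (q ^ 2 * (T : ℝ) ^ n) := by
    have h := sum_card_missedTests_sq_le (ι := ι) T L
    rw [← hn] at h
    have h' : (∑ f : ι → Fin L → Fin T, ((missedTests f).card : ℝ) ^ 2) ≤
        T * ((T : ℝ) - 1) ^ n + (T : ℝ) ^ 2 * ((T - 2 : ℕ) : ℝ) ^ n := by
      have h3 : ((∑ f : ι → Fin L → Fin T, (missedTests f).card ^ 2 : ℕ) : ℝ) ≤
        ((T * (T - 1) ^ n + T ^ 2 * (T - 2) ^ n : ℕ) : ℝ) := by exact_mod_cast h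
      push_cast [Nat.cast_sub hT] at h3
      exact h3
    have h4 : ((T - 2 : ℕ) : ℝ) ^ n ≤ q ^ 2 * (T : ℝ) ^ n := by
      have h5 : ((T - 2 : ℕ) : ℝ) ≤ (((T : ℝ) - 1) / T) ^ 2 * T := by
        rw [div_pow, div_mul_eq_mul_div, le_div_iff₀ (by positivity)]
        rcases Nat.lt_or_ge T 2 with h | h
        · have : T - 2 = 0 := by omega
          rw [this]
          simp only [Nat.cast_zero, zero_mul]
          positivity
        · push_cast [Nat.cast_sub h]
          nlinarith
      calc ((T - 2 : ℕ) : ℝ) ^ n ≤ ((((T : ℝ) - 1) / T) ^ 2 * T) ^ n := by gcongr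
        _ = q ^ 2 * (T : ℝ) ^ n := by rw [hq, mul_pow, pow_right_comm]
    have h6 : q * (T : ℝ) ^ n = ((T : ℝ) - 1) ^ n := by
      rw [hq, div_pow, div_mul_cancel₀ _ (by positivity)]
    rw [h6]
    exact h'.trans (by gcongr)
  have hcard : ∑ _f : ι → Fin L → Fin T, (1 : ℝ) = (T : ℝ) ^ n := by
    simp [hn, ← pow_mul, mul_comm]
  have hq1 : q ≤ 1 := by
    refine pow_le_one₀ (div_nonneg (by linarith) hT0.le) ?_
    rw [div_le_one hT0]
    linarith
  have hexp : ∑ f : ι → Fin L → Fin T, ((missedTests f).card - T * q) ^ 2 =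
      ∑ f : ι → Fin L → Fin T, ((missedTests f).card : ℝ) ^ 2 -
        2 * (T * q) * ∑ f : ι → Fin L → Fin T, ((missedTests f).card : ℝ) +
        (T * q) ^ 2 * ∑ _f : ι → Fin L → Fin T, (1 : ℝ) := by
    rw [Finset.mul_sum, Finset.mul_sum, ← Finset.sum_sub_distrib, ← Finset.sum_add_distrib]
    exact Finset.sum_congr rfl fun f _ => by ring
  rw [hexp, h1, hcard]
  have hpos : 0 ≤ T * (T : ℝ) ^ n := by positivity
  nlinarith [mul_le_mul_of_nonneg_left hq1 hpos]

theorem card_filter_card_hitTests_lt_le {ι : Type*} [Fintype ι] [DecidableEq ι] {T : ℕ} (L : ℕ)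
    (hT : 1 ≤ T) {δ : ℝ} (hδ : 0 < δ) :
    open Classical in
    ((Finset.univ.filter fun f : ι → Fin L → Fin T => ((hitTests f).card : ℝ) <
      (1 - Real.exp (-((Fintype.card ι * L : ℕ) / T)) - δ) * T).card : ℝ) ≤
      1 / (δ ^ 2 * T) * (T : ℝ) ^ (Fintype.card ι * L) := by
  classical
  set n := Fintype.card ι * L with hn
  have hT0 : (0 : ℝ) < T := by exact_mod_cast hT
  have hT1 : (1 : ℝ) ≤ T := by exact_mod_cast hT
  have hqe : (((T : ℝ) - 1) / T) ^ n ≤ Real.exp (-((n : ℕ) / T)) := by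
    have h : ((T : ℝ) - 1) / T ≤ Real.exp (-(1 / T)) := by
      have := Real.add_one_le_exp (-(1 / (T : ℝ)))
      have h' : ((T : ℝ) - 1) / T = -(1 / T) + 1 := by field_simp; ring
      rwa [h']
    calc (((T : ℝ) - 1) / T) ^ n ≤ Real.exp (-(1 / T)) ^ n :=
          pow_le_pow_left₀ (div_nonneg (by linarith) hT0.le) h n
      _ = Real.exp (-((n : ℕ) / T)) := by rw [← Real.exp_nat_mul]; congr 1; ring
  have hvar := sum_card_missedTests_sub_sq_le (ι := ι) L hT
  rw [← hn] at hvar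
  set B := Finset.univ.filter fun f : ι → Fin L → Fin T => ((hitTests f).card : ℝ) <
      (1 - Real.exp (-((n : ℕ) / T)) - δ) * T with hB
  have hle : (B.card : ℝ) * (δ * T) ^ 2 ≤ (T : ℝ) ^ n * T := by
    refine le_trans ?_ hvar
    rw [← nsmul_eq_mul, ← Finset.sum_const]
    refine le_trans (Finset.sum_le_sum fun f hf => ?_)
      (Finset.sum_le_sum_of_subset_of_nonneg (Finset.subset_univ B) fun f _ _ => sq_nonneg _)
    have hf' := (Finset.mem_filter.1 hf).2
    have hadd : ((hitTests f).card : ℝ) + (missedTests f).card = T := by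
      exact_mod_cast card_hitTests_add_card_missedTests f
    refine pow_le_pow_left₀ (by positivity) ?_ 2
    nlinarith [mul_le_mul_of_nonneg_left hqe hT0.le]
  rw [div_mul_eq_mul_div, one_mul, le_div_iff₀ (by positivity)]
  have : (B.card : ℝ) * (δ ^ 2 * T) * T ≤ (T : ℝ) ^ n * T := by nlinarith
  exact le_of_mul_le_mul_right this hT0

theorem card_compSucceeds_le {N T L : ℕ} (S : Finset (Fin N)) :
    Nat.card {X : Fin N → Fin L → Fin T // CompSucceeds S X} ≤
      ∑ f : {i // i ∈ S} → Fin L → Fin T,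
        (T ^ L - (hitTests f).card ^ L) ^ (N - S.card) := by
  classical
  let G (f : {i // i ∈ S} → Fin L → Fin T) : Finset ({i // i ∉ S} → Fin L → Fin T) :=
    Fintype.piFinset fun _ => (Fintype.piFinset fun _ => hitTests f)ᶜ
  have hG : ∀ f, (G f).card = (T ^ L - (hitTests f).card ^ L) ^ (N - S.card) := by
    intro f
    simp [G, Fintype.card_piFinset, Finset.card_compl, Fintype.card_subtype_compl]
  simp_rw [← hG]
  rw [← Finset.card_sigma, Nat.card_eq_fintype_card, ← Finset.card_univ]
  refine Finset.card_le_card_of_injOn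
    (fun X => ⟨fun i => X.1 i.1, fun i => X.1 i.1⟩) ?_ ?_
  · rintro ⟨X, hX⟩ -
    simp only [Finset.coe_sigma, Set.mem_sigma_iff, Finset.coe_univ, Set.mem_univ, true_and,
      SetLike.mem_coe, G, Fintype.mem_piFinset, Finset.mem_compl]
    rintro ⟨i, hi⟩ hall
    have hmem : i ∈ (S : Set (Fin N)) := by
      rw [← hX]
      intro l
      obtain ⟨j, l', h⟩ := (mem_hitTests _ _).1 (hall l)
      exact ⟨j.1, j.2, l', h⟩
    exact hi hmem
  · rintro ⟨X, hX⟩ - ⟨Y, hY⟩ - h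
    simp only [Sigma.mk.injEq, heq_eq_eq] at h
    refine Subtype.ext (funext fun i => ?_)
    by_cases hi : i ∈ S
    · exact congrFun h.1 ⟨i, hi⟩
    · exact congrFun h.2 ⟨i, hi⟩

theorem card_compSucceeds_le_mul {N T L : ℕ} (S : Finset (Fin N)) {w ρ : ℝ} (hw : 0 ≤ w)
    (h : open Classical in ((Finset.univ.filter fun f : {i // i ∈ S} → Fin L → Fin T =>
      ((hitTests f).card : ℝ) < w * T).card : ℝ) ≤ ρ * (T : ℝ) ^ (S.card * L)) :
    (Nat.card {X : Fin N → Fin L → Fin T // CompSucceeds S X} : ℝ) ≤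
      (ρ + Real.exp (-(((N - S.card : ℕ) : ℝ) * w ^ L))) * (T : ℝ) ^ (N * L) := by
  classical
  have hSN : S.card ≤ N := by simpa using Finset.card_le_univ S
  set m := N - S.card with hm
  have hNL : (T : ℝ) ^ (N * L) = (T : ℝ) ^ (S.card * L) * ((T : ℝ) ^ L) ^ m := by
    rw [← pow_mul, ← pow_add]
    congr 1
    have : N = S.card + m := by omega
    conv_lhs => rw [this]
    ring
  have hhit : ∀ f : {i // i ∈ S} → Fin L → Fin T, (hitTests f).card ^ L ≤ T ^ L := fun f =>
    Nat.pow_le_pow_left (by simpa using Finset.card_le_univ (hitTests f)) L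
  have hterm : ∀ f : {i // i ∈ S} → Fin L → Fin T,
      (((T ^ L - (hitTests f).card ^ L) ^ m : ℕ) : ℝ) ≤
      (if ((hitTests f).card : ℝ) < w * T then ((T : ℝ) ^ L) ^ m else 0) +
        Real.exp (-((m : ℝ) * w ^ L)) * ((T : ℝ) ^ L) ^ m := by
    intro f
    push_cast [Nat.cast_sub (hhit f)]
    have hnn : (0 : ℝ) ≤ (T : ℝ) ^ L - ((hitTests f).card : ℝ) ^ L := by
      rw [sub_nonneg]; exact_mod_cast hhit f
    split_ifs with hf
    · refine le_add_of_le_of_nonneg (pow_le_pow_left₀ hnn ?_ m) (by positivity)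
      exact sub_le_self _ (by positivity)
    · rw [zero_add]
      have hexp : Real.exp (-((m : ℝ) * w ^ L)) = Real.exp (-(w ^ L)) ^ m := by
        rw [← Real.exp_nat_mul]; congr 1; ring
      rw [hexp, ← mul_pow]
      refine pow_le_pow_left₀ hnn ?_ m
      have h1 : (w * T) ^ L ≤ ((hitTests f).card : ℝ) ^ L :=
        pow_le_pow_left₀ (by positivity) (not_lt.1 hf) L
      rw [mul_pow] at h1
      have h2 := Real.add_one_le_exp (-(w ^ L))
      nlinarith [mul_le_mul_of_nonneg_right h2 (by positivity : (0 : ℝ) ≤ (T : ℝ) ^ L)]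
  calc (Nat.card {X : Fin N → Fin L → Fin T // CompSucceeds S X} : ℝ)
      ≤ ∑ f : {i // i ∈ S} → Fin L → Fin T,
          (((T ^ L - (hitTests f).card ^ L) ^ m : ℕ) : ℝ) := by
        exact_mod_cast card_compSucceeds_le S
    _ ≤ ∑ f : {i // i ∈ S} → Fin L → Fin T,
          ((if ((hitTests f).card : ℝ) < w * T then ((T : ℝ) ^ L) ^ m else 0) +
            Real.exp (-((m : ℝ) * w ^ L)) * ((T : ℝ) ^ L) ^ m) :=
        Finset.sum_le_sum fun f _ => hterm f
    _ = ((Finset.univ.filter fun f : {i // i ∈ S} → Fin L → Fin T =>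
          ((hitTests f).card : ℝ) < w * T).card : ℝ) * ((T : ℝ) ^ L) ^ m +
          (T : ℝ) ^ (S.card * L) * (Real.exp (-((m : ℝ) * w ^ L)) * ((T : ℝ) ^ L) ^ m) := by
        rw [Finset.sum_add_distrib, ← Finset.sum_filter]
        simp [← pow_mul, mul_comm]
    _ ≤ ρ * (T : ℝ) ^ (S.card * L) * ((T : ℝ) ^ L) ^ m +
          (T : ℝ) ^ (S.card * L) * (Real.exp (-((m : ℝ) * w ^ L)) * ((T : ℝ) ^ L) ^ m) := by
        gcongr
    _ = _ := by rw [hNL]; ring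

theorem compSuccessProb_le {N K T L : ℕ} {w ρ : ℝ} (hw : 0 ≤ w) (hρ : 0 ≤ ρ)
    (h : ∀ S : Finset (Fin N), S.card = K → open Classical in
      ((Finset.univ.filter fun f : {i // i ∈ S} → Fin L → Fin T =>
      ((hitTests f).card : ℝ) < w * T).card : ℝ) ≤ ρ * (T : ℝ) ^ (K * L)) :
    compSuccessProb N K T L ≤ ρ + Real.exp (-(((N - K : ℕ) : ℝ) * w ^ L)) := by
  classical
  unfold compSuccessProb
  refine div_le_of_le_mul₀ (by positivity) (by positivity) ?_
  have e : {ω : {S : Finset (Fin N) // S.card = K} × (Fin N → Fin L → Fin T) //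
      CompSucceeds ω.1.1 ω.2} ≃ (S : {S : Finset (Fin N) // S.card = K}) ×
      {X : Fin N → Fin L → Fin T // CompSucceeds S.1 X} :=
    Equiv.subtypeProdEquivSigmaSubtype
      (fun (S : {S : Finset (Fin N) // S.card = K}) X => CompSucceeds S.1 X)
  rw [Nat.card_congr e, Nat.card_sigma, Nat.card_prod]
  push_cast
  have hcard : (Nat.card (Fin N → Fin L → Fin T) : ℝ) = (T : ℝ) ^ (N * L) := by
    simp [← pow_mul, mul_comm]
  rw [hcard]
  calc _ ≤ ∑ _S : {S : Finset (Fin N) // S.card = K},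
        (ρ + Real.exp (-(((N - K : ℕ) : ℝ) * w ^ L))) * (T : ℝ) ^ (N * L) := by
        refine Finset.sum_le_sum fun S _ => ?_
        have hS := card_compSucceeds_le_mul S.1 hw (by rw [S.2]; exact h S.1 S.2)
        rwa [S.2] at hS
    _ = _ := by
        rw [Finset.sum_const, nsmul_eq_mul, Finset.card_univ, Nat.card_eq_fintype_card]
        ring

theorem compSuccessProb_le_of_weight_zero (N K T : ℕ) :
    compSuccessProb N K T 0 ≤ Real.exp (-((N - K : ℕ) : ℝ)) := by
  have h := compSuccessProb_le (N := N) (K := K) (T := T) (L := 0) (w := 0) (ρ := 0)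
    le_rfl le_rfl (fun S _ => by simp [not_lt.2 (Nat.cast_nonneg _)])
  simpa using h

theorem compSuccessProb_le_exp {N K T L : ℕ} (hK : 1 ≤ K) (hT : 1 ≤ T) (hL : 1 ≤ L) :
    compSuccessProb N K T L ≤ Real.exp (-(((N - K : ℕ) : ℝ) * (1 / (T : ℝ)) ^ L)) := by
  classical
  have hT0 : (0 : ℝ) < T := by exact_mod_cast hT
  have h := compSuccessProb_le (N := N) (K := K) (T := T) (L := L) (w := 1 / T) (ρ := 0)
    (by positivity) le_rfl (fun S hS => by
      rw [div_mul_cancel₀ _ hT0.ne', zero_mul]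
      refine le_of_eq ?_
      rw [Nat.cast_eq_zero, Finset.card_eq_zero, Finset.filter_eq_empty_iff]
      intro f _
      obtain ⟨i, hi⟩ : S.Nonempty := Finset.card_pos.1 (by omega)
      have hmem : f ⟨i, hi⟩ ⟨0, hL⟩ ∈ hitTests f :=
        (mem_hitTests _ _).2 ⟨⟨i, hi⟩, ⟨0, hL⟩, rfl⟩
      rw [not_lt]
      exact_mod_cast Finset.card_pos.2 ⟨_, hmem⟩)
  simpa using h

theorem compSuccessProb_le_add {N K T L : ℕ} (hT : 1 ≤ T) {δ : ℝ} (hδ : 0 < δ)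
    (hw : 0 ≤ 1 - Real.exp (-((K * L : ℕ) / T)) - δ) :
    compSuccessProb N K T L ≤ 1 / (δ ^ 2 * T) +
      Real.exp (-(((N - K : ℕ) : ℝ) * (1 - Real.exp (-((K * L : ℕ) / T)) - δ) ^ L)) := by
  classical
  refine compSuccessProb_le hw (by positivity) fun S hS => ?_
  have h := card_filter_card_hitTests_lt_le (ι := {i // i ∈ S}) L hT hδ
  simp only [Fintype.card_coe, hS] at h
  exact h

theorem log_mul_log_one_sub_le {x : ℝ} (hx0 : 0 < x) (hx1 : x < 1) :
    Real.log x * Real.log (1 - x) ≤ Real.log 2 ^ 2 := by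
  have hhalf : ∀ y : ℝ, 0 < y → y ≤ 1 / 2 →
      Real.log y * Real.log (1 - y) ≤ Real.log 2 ^ 2 := by
    have hder : ∀ y : ℝ, 0 < y → y < 1 → HasDerivAt (fun y => Real.log y * Real.log (1 - y))
        (y⁻¹ * Real.log (1 - y) + Real.log y * (-1 / (1 - y))) y := by
      intro y h0 h1
      have h := (Real.hasDerivAt_log h0.ne').mul
        (((hasDerivAt_id y).const_sub 1).log (by simp only [id]; linarith))
      simp only [id] at h
      exact h
    have hmono : MonotoneOn (fun y => Real.log y * Real.log (1 - y))
        (Set.Ioc (0 : ℝ) (1 / 2)) := by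
      refine monotoneOn_of_deriv_nonneg (convex_Ioc _ _) ?_ ?_ ?_
      · intro y hy
        exact (hder y hy.1 (by linarith [hy.2])).continuousAt.continuousWithinAt
      · intro y hy
        have hy' := interior_subset hy
        exact (hder y hy'.1 (by linarith [hy'.2])).differentiableAt.differentiableWithinAt
      · intro y hy
        rw [interior_Ioc] at hy
        obtain ⟨h0, h2⟩ := hy
        rw [(hder y h0 (by linarith)).deriv]
        have hs := strictConcaveOn_log_Ioi.concaveOn.slope_anti_adjacent
          (x := y) (y := 1 - y) (z := 1) h0 (Set.mem_Ioi.2 one_pos) (by linarith) (by linarith)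
        rw [Real.log_one] at hs
        rw [div_le_div_iff₀ (by linarith) (by linarith)] at hs
        have h1y : 0 < 1 - y := by linarith
        have : y⁻¹ * Real.log (1 - y) + Real.log y * (-1 / (1 - y)) =
            ((1 - y) * Real.log (1 - y) - y * Real.log y) / (y * (1 - y)) := by
          field_simp
          ring
        rw [this]
        refine div_nonneg ?_ (by positivity)
        nlinarith
    intro y h0 h2
    have h := hmono ⟨h0, h2⟩ ⟨by norm_num, le_rfl⟩ h2
    have h12 : Real.log (1 / 2) = -Real.log 2 := by rw [one_div, Real.log_inv]
    have h12' : (1 : ℝ) - 1 / 2 = 1 / 2 := by norm_num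
    simp only [h12', h12] at h
    nlinarith
  rcases le_total x (1 / 2) with h | h
  · exact hhalf x hx0 h
  · have := hhalf (1 - x) (by linarith) (by linarith)
    rw [sub_sub_cancel] at this
    linarith

theorem exp_neg_le_mul_one_sub_exp_pow {K T L : ℕ} (hK : 1 ≤ K) (hT : 1 ≤ T) (hL : 1 ≤ L)
    (s : ℝ) :
    Real.exp (-(s * L + T / K * Real.log 2 ^ 2)) ≤
      (Real.exp (-s) * (1 - Real.exp (-((K * L : ℕ) / T)))) ^ L := by
  have hK0 : (0 : ℝ) < K := by exact_mod_cast hK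
  have hT0 : (0 : ℝ) < T := by exact_mod_cast hT
  have hL0 : (0 : ℝ) < L := by exact_mod_cast hL
  set c : ℝ := (K * L : ℕ) / T with hc
  have hc0 : 0 < c := by rw [hc]; push_cast; positivity
  have hx1 : Real.exp (-c) < 1 := by rw [Real.exp_lt_one_iff]; linarith
  have hlog := log_mul_log_one_sub_le (Real.exp_pos (-c)) hx1
  rw [Real.log_exp] at hlog
  have hLc : (L : ℝ) = T / K * c := by rw [hc]; push_cast; field_simp
  have hTK : (0 : ℝ) < T / K := by positivity
  have hpos : 0 < 1 - Real.exp (-c) := by linarith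
  calc Real.exp (-(s * L + T / K * Real.log 2 ^ 2))
      ≤ Real.exp (L * (-s + Real.log (1 - Real.exp (-c)))) := by
        rw [Real.exp_le_exp]
        have h1 : (L : ℝ) * Real.log (1 - Real.exp (-c)) =
            -(T / K * (-c * Real.log (1 - Real.exp (-c)))) := by rw [hLc]; ring
        have h2 := mul_le_mul_of_nonneg_left hlog hTK.le
        rw [mul_add, h1]
        linarith
    _ = _ := by rw [Real.exp_nat_mul, Real.exp_add, Real.exp_log hpos]

theorem eventually_le_half {K : ℕ → ℕ} {θ b : ℝ} (hθ1 : θ < 1)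
    (hK : ∀ N : ℕ, (K N : ℝ) ≤ b * (N : ℝ) ^ θ) :
    ∀ᶠ N : ℕ in atTop, (K N : ℝ) ≤ N / 2 := by
  have h : Tendsto (fun N : ℕ => b * (N : ℝ) ^ (-(1 - θ))) atTop (nhds (b * 0)) :=
    ((tendsto_rpow_neg_atTop (by linarith)).comp tendsto_natCast_atTop_atTop).const_mul b
  rw [mul_zero] at h
  filter_upwards [h.eventually (gt_mem_nhds (by norm_num : (0 : ℝ) < 1 / 2)),
    eventually_gt_atTop 0] with N hN hpos
  have hN0 : (0 : ℝ) < N := by exact_mod_cast hpos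
  have hsplit : (N : ℝ) ^ θ = (N : ℝ) ^ (-(1 - θ)) * N := by
    rw [← Real.rpow_add_one hN0.ne']
    congr 1
    ring
  have h1 := hK N
  rw [hsplit] at h1
  nlinarith

theorem compSuccessProb_nonneg (N K T L : ℕ) : 0 ≤ compSuccessProb N K T L := by
  unfold compSuccessProb
  positivity

theorem compSuccessProb_le_of_le {N K T T₀ L : ℕ} {ν : ℝ} (hν : 0 < ν) (hK : 1 ≤ K)
    (hT : 1 ≤ T) (hL : 1 ≤ L) (hTT : T ≤ T₀) (hLν : (L : ℝ) ≤ ν * T / K) :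
    compSuccessProb N K T L ≤
      Real.exp (-(((N - K : ℕ) : ℝ) * (1 / (T₀ : ℝ)) ^ ⌈ν * T₀⌉₊)) := by
  have hT0 : (0 : ℝ) < T := by exact_mod_cast hT
  have hTT' : (T : ℝ) ≤ T₀ := by exact_mod_cast hTT
  have hK1 : (1 : ℝ) ≤ K := by exact_mod_cast hK
  have hLM : L ≤ ⌈ν * T₀⌉₊ := by
    have h1 : ν * T / K ≤ ν * T₀ := (div_le_self (by positivity) hK1).trans (by gcongr)
    exact_mod_cast (hLν.trans h1).trans (Nat.le_ceil _)
  refine (compSuccessProb_le_exp hK hT hL).trans ?_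
  rw [Real.exp_le_exp, neg_le_neg_iff]
  refine mul_le_mul_of_nonneg_left ?_ (by positivity)
  calc (1 / (T₀ : ℝ)) ^ ⌈ν * T₀⌉₊ ≤ (1 / (T₀ : ℝ)) ^ L :=
        pow_le_pow_of_le_one (by positivity)
          (by rw [div_le_one (by linarith)]; exact_mod_cast hT.trans hTT) hLM
    _ ≤ (1 / (T : ℝ)) ^ L := by gcongr

theorem compSuccessProb_le_of_weight_eq_floor {N K T : ℕ} {ν s : ℝ} (hν : 0 < ν) (hs : 0 < s)
    (hK : 1 ≤ K) (hT : 1 ≤ T) (hL : 1 ≤ ⌊ν * (T : ℝ) / (K : ℝ)⌋₊) :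
    compSuccessProb N K T ⌊ν * (T : ℝ) / (K : ℝ)⌋₊ ≤
      1 / (((1 - Real.exp (-s)) * (1 - Real.exp (-(ν / 2)))) ^ 2 * T) +
        Real.exp (-(((N - K : ℕ) : ℝ) *
          Real.exp (-((s * ν + Real.log 2 ^ 2) * (T / K : ℝ))))) := by
  have hK0 : (0 : ℝ) < K := by exact_mod_cast hK
  have hT0 : (0 : ℝ) < T := by exact_mod_cast hT
  have hLle : (⌊ν * (T : ℝ) / (K : ℝ)⌋₊ : ℝ) ≤ ν * T / K := Nat.floor_le (by positivity)
  have hLlt : ν * T / K < (⌊ν * (T : ℝ) / (K : ℝ)⌋₊ : ℝ) + 1 := Nat.lt_floor_add_one _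
  set L := ⌊ν * (T : ℝ) / (K : ℝ)⌋₊
  have hL1 : (1 : ℝ) ≤ L := by exact_mod_cast hL
  have hc : ν / 2 ≤ ((K * L : ℕ) : ℝ) / T := by
    have h : ν * T / K ≤ 2 * L := by linarith
    rw [div_le_iff₀ hK0] at h
    rw [le_div_iff₀ hT0]
    push_cast
    linarith
  have hη : 0 < 1 - Real.exp (-s) := by
    rw [sub_pos, Real.exp_lt_one_iff]
    linarith
  have hν2 : 0 < 1 - Real.exp (-(ν / 2)) := by
    rw [sub_pos, Real.exp_lt_one_iff]
    linarith
  set q := Real.exp (-(((K * L : ℕ) : ℝ) / T)) with hq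
  have hqle : q ≤ Real.exp (-(ν / 2)) := by
    rw [hq, Real.exp_le_exp]
    linarith
  set δ := (1 - Real.exp (-s)) * (1 - Real.exp (-(ν / 2))) with hδ
  have hδ0 : 0 < δ := by positivity
  have hw : Real.exp (-s) * (1 - q) ≤ 1 - q - δ := by
    have : δ ≤ (1 - Real.exp (-s)) * (1 - q) := by rw [hδ]; gcongr
    linarith
  have hw0 : 0 ≤ Real.exp (-s) * (1 - q) := mul_nonneg (Real.exp_pos _).le (by linarith)
  refine (compSuccessProb_le_add hT hδ0 (hw0.trans hw)).trans ?_
  rw [← hq]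
  gcongr
  calc Real.exp (-((s * ν + Real.log 2 ^ 2) * (T / K : ℝ)))
      ≤ Real.exp (-(s * L + T / K * Real.log 2 ^ 2)) := by
        rw [Real.exp_le_exp]
        have := mul_le_mul_of_nonneg_left hLle hs.le
        have h2 : s * (ν * T / K) = s * ν * (T / K) := by ring
        linarith
    _ ≤ (Real.exp (-s) * (1 - q)) ^ L := exp_neg_le_mul_one_sub_exp_pow hK hT hL s
    _ ≤ _ := pow_le_pow_left₀ hw0 hw L

/-- COMP converse for near-constant column weight designs:
if `K = Θ(N^θ)` with `θ ∈ [0,1)` and `T ≤ (1−ε)·(1/ln 2)·K·log₂ N`, then for any `ν > 0`,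
with per-item weight `L = ⌊ν·T/K⌋` the COMP success probability tends to `0`. -/
theorem comp_success_tendsto_zero
    (θ ε ν a b : ℝ) (hθ0 : 0 ≤ θ) (hθ1 : θ < 1) (hε : 0 < ε) (hν : 0 < ν)
    (ha : 0 < a) (hab : a ≤ b)
    (K T : ℕ → ℕ)
    (hK : ∀ N : ℕ, a * (N : ℝ) ^ θ ≤ (K N : ℝ) ∧ (K N : ℝ) ≤ b * (N : ℝ) ^ θ)
    (hT : ∀ N : ℕ, (T N : ℝ) ≤ (1 - ε) * (1 / Real.log 2) * (K N : ℝ) * Real.logb 2 N) :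
    Tendsto (fun N => compSuccessProb N (K N) (T N) ⌊ν * (T N : ℝ) / (K N : ℝ)⌋₊)
      atTop (nhds 0) := by
  have hlog2 : 0 < Real.log 2 := Real.log_pos one_lt_two
  set C : ℝ := (1 - ε) / Real.log 2 ^ 2 with hC
  set D : ℝ := |C| + 1 with hD
  have hD0 : 0 < D := by positivity
  set s : ℝ := ε / (2 * ν * D) with hs
  have hs0 : 0 < s := by positivity
  set δ : ℝ := (1 - Real.exp (-s)) * (1 - Real.exp (-(ν / 2))) with hδ
  have hδ0 : 0 < δ := by
    refine mul_pos ?_ ?_ <;> rw [sub_pos, Real.exp_lt_one_iff] <;> linarith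
  refine tendsto_order.2 ⟨fun x hx => Eventually.of_forall fun N =>
    hx.trans_le (compSuccessProb_nonneg _ _ _ _), fun τ hτ => ?_⟩
  set T₀ : ℕ := ⌈2 / (δ ^ 2 * τ)⌉₊ + 1 with hT₀
  have hT₀pos : (0 : ℝ) < T₀ := by rw [hT₀]; positivity
  set κ : ℝ := (1 / (T₀ : ℝ)) ^ ⌈ν * T₀⌉₊ with hκ
  have hκ0 : 0 < κ := by positivity
  have hcast : Tendsto (fun N : ℕ => (N : ℝ)) atTop atTop := tendsto_natCast_atTop_atTop
  have hlim : ∀ {u : ℕ → ℝ}, Tendsto u atTop atTop → ∀ {r : ℝ}, 0 < r →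
      ∀ᶠ N in atTop, Real.exp (-(u N)) < r := fun hu r hr =>
    (Real.tendsto_exp_neg_atTop_nhds_zero.comp hu).eventually (gt_mem_nhds hr)
  have hzero := hlim (hcast.atTop_div_const two_pos) hτ
  have hsmall := hlim ((hcast.atTop_div_const two_pos).atTop_mul_const hκ0) hτ
  have hlarge := hlim (((tendsto_rpow_atTop (half_pos hε)).comp hcast).atTop_div_const two_pos)
    (half_pos hτ)
  filter_upwards [eventually_le_half hθ1 fun N => (hK N).2, eventually_ge_atTop 1, hzero, hsmall,
    hlarge] with N hKN hN1 hz hsm hlg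
  have hN0 : (0 : ℝ) < N := by exact_mod_cast hN1
  have hlogN : 0 ≤ Real.log N := Real.log_natCast_nonneg N
  have hK0 : (0 : ℝ) < K N := lt_of_lt_of_le (by positivity) (hK N).1
  have hK1 : 1 ≤ K N := by exact_mod_cast hK0
  have hsub : (N : ℝ) / 2 ≤ ((N - K N : ℕ) : ℝ) := by
    rw [Nat.cast_sub (by exact_mod_cast hKN.trans (half_le_self hN0.le))]
    linarith
  rcases Nat.eq_zero_or_pos ⌊ν * (T N : ℝ) / (K N : ℝ)⌋₊ with hL | hL
  · rw [hL]
    refine (compSuccessProb_le_of_weight_zero _ _ _).trans_lt (lt_of_le_of_lt ?_ hz)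
    rw [Real.exp_le_exp]
    linarith
  have hT1 : 1 ≤ T N := by
    by_contra h
    have : T N = 0 := by omega
    simp [this] at hL
  rcases le_or_gt (T N) T₀ with hTT | hTT
  · refine (compSuccessProb_le_of_le hν hK1 hT1 hL hTT (Nat.floor_le (by positivity))).trans_lt
      (lt_of_le_of_lt ?_ hsm)
    rw [Real.exp_le_exp, neg_le_neg_iff]
    exact mul_le_mul_of_nonneg_right hsub hκ0.le
  have hTT' : (T₀ : ℝ) < T N := by exact_mod_cast hTT
  have hratio : (T N : ℝ) / K N ≤ C * Real.log N := by
    rw [div_le_iff₀ hK0]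
    refine (hT N).trans (le_of_eq ?_)
    rw [hC, Real.logb]
    field_simp
  have hratioD : (T N : ℝ) / K N ≤ D * Real.log N :=
    hratio.trans (mul_le_mul_of_nonneg_right (by linarith [le_abs_self C]) hlogN)
  have hexponent : (s * ν + Real.log 2 ^ 2) * ((T N : ℝ) / K N) ≤
      (1 - ε / 2) * Real.log N := by
    have h1 := mul_le_mul_of_nonneg_left hratioD (mul_pos hs0 hν).le
    have h2 := mul_le_mul_of_nonneg_left hratio (sq_nonneg (Real.log 2))
    have h3 : s * ν * (D * Real.log N) = ε / 2 * Real.log N := by rw [hs]; field_simp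
    have h4 : Real.log 2 ^ 2 * (C * Real.log N) = (1 - ε) * Real.log N := by
      rw [hC]; field_simp
    linarith
  have hmain : (N : ℝ) ^ (ε / 2) / 2 ≤ ((N - K N : ℕ) : ℝ) *
      Real.exp (-((s * ν + Real.log 2 ^ 2) * ((T N : ℝ) / K N))) := by
    have h1 : (N : ℝ) ^ (ε / 2) / 2 =
        N / 2 * Real.exp (-((1 - ε / 2) * Real.log N)) := by
      have h2 : (N : ℝ) ^ (ε / 2) = N * Real.exp (-((1 - ε / 2) * Real.log N)) := by
        conv_rhs => rw [← Real.exp_log hN0, Real.log_exp, ← Real.exp_add]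
        rw [Real.rpow_def_of_pos hN0]
        congr 1
        ring
      rw [h2]
      ring
    rw [h1]
    gcongr
  have hcheb : 1 / (δ ^ 2 * T N) ≤ τ / 2 := by
    have h1 : 2 / (δ ^ 2 * τ) ≤ T N :=
      (Nat.le_ceil _).trans ((by rw [hT₀]; push_cast; linarith : _ ≤ (T₀ : ℝ)).trans hTT'.le)
    rw [div_le_iff₀ (by positivity)] at h1 ⊢
    linarith
  have hbound := compSuccessProb_le_of_weight_eq_floor (N := N) hν hs0 hK1 hT1 hL
  rw [← hδ] at hbound
  have hexp := (Real.exp_le_exp.2 (neg_le_neg hmain)).trans_lt hlg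
  linarith
end

section
/- Fix θ ∈ (0,1), ε > 0 and constants 0 < a ≤ b. For each N, let K = K(N) be a natural number with a·N^θ ≤ K ≤ b·N^θ, let T = T(N) satisfy T ≥ (1+ε)·(1/ln 2)·max{ K·log₂(N/K), K·log₂ K }, and run the near-constant column weight design with per-item weight L = ⌊(ln 2)·T/K⌋. Then the success probability of the DD algorithm tends to 1 as N → ∞. -/
open Filter

/-- The possible defectives: items appearing in no negative test, i.e. all of whose tests
are positive. -/
def PossibleDefectives {N T L : ℕ} (S : Finset (Fin N)) (X : Fin N → Fin L → Fin T) :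
    Set (Fin N) :=
  {i : Fin N | ∀ l : Fin L, IsPositive S X (X i l)}

/-- DD succeeds iff the set of items appearing in some positive test containing no other
possible defective equals the defective set `S`.  (Every test containing item `i` is of the
form `X i l` for some `l : Fin L`.) -/
def DDSucceeds {N T L : ℕ} (S : Finset (Fin N)) (X : Fin N → Fin L → Fin T) : Prop :=
  {i : Fin N | ∃ l : Fin L, IsPositive S X (X i l) ∧
      ∀ j : Fin N, j ≠ i → j ∈ PossibleDefectives S X → ∀ l' : Fin L, X j l' ≠ X i l}
    = (S : Set (Fin N))

/-- Success probability of DD under the near-constant column weight design: the defective set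
is uniform over the `K`-subsets of the `N` items, and independently each item picks `L` tests
uniformly at random with replacement from the `T` tests. -/
noncomputable def ddSuccessProb (N K T L : ℕ) : ℝ :=
  (Nat.card {ω : {S : Finset (Fin N) // S.card = K} × (Fin N → Fin L → Fin T) //
      DDSucceeds ω.1.1 ω.2} : ℝ) /
    (Nat.card ({S : Finset (Fin N) // S.card = K} × (Fin N → Fin L → Fin T)) : ℝ)

section Counting

open Finset

/-- Generating-function bound for the number of tests outside `Q` hit by a random column. -/
theorem sum_pow_card_image_sdiff_le {z : ℝ} (hz : 0 ≤ z) {T : ℕ} (L : ℕ) (Q : Finset (Fin T)) :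
    ∑ x : Fin L → Fin T, z ^ #(univ.image x \ Q) ≤ (#Q + L + z * T) ^ L := by
  induction L generalizing Q with
  | zero => simp
  | succ L ih =>
    have himage (t : Fin T) (x : Fin L → Fin T) :
        univ.image (Fin.cons t x : Fin (L + 1) → Fin T) = insert t (univ.image x) := by
      ext u
      simp [Fin.exists_fin_succ, eq_comm]
    have hstep (t : Fin T) :
        ∑ x : Fin L → Fin T, z ^ #(insert t (univ.image x) \ Q) ≤
          (if t ∈ Q then 1 else z) * (#Q + (L + 1) + z * T) ^ L := by
      split_ifs with ht
      · simp only [insert_sdiff_of_mem _ ht, one_mul]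
        refine (ih Q).trans ?_
        gcongr
        linarith
      · have hcard (x : Fin L → Fin T) :
            #(insert t (univ.image x) \ Q) = #(univ.image x \ insert t Q) + 1 := by
          have : insert t (univ.image x) \ Q = insert t (univ.image x \ insert t Q) := by
            ext u
            simp only [mem_insert]
            by_cases hu : u = t <;> simp [hu, ht]
          rw [this, card_insert_of_notMem (by simp)]
        simp only [hcard, pow_succ', ← mul_sum]
        refine mul_le_mul_of_nonneg_left ((ih (insert t Q)).trans (le_of_eq ?_)) hz
        rw [card_insert_of_notMem ht]
        push_cast
        ring
    calc ∑ x : Fin (L + 1) → Fin T, z ^ #(univ.image x \ Q)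
        = ∑ t : Fin T, ∑ x : Fin L → Fin T, z ^ #(insert t (univ.image x) \ Q) := by
          rw [← (Fin.consEquiv fun _ => Fin T).sum_comp, Fintype.sum_prod_type]
          simp [Fin.consEquiv, himage]
      _ ≤ ∑ t : Fin T, (if t ∈ Q then 1 else z) * (#Q + (L + 1) + z * T) ^ L :=
          sum_le_sum fun t _ => hstep t
      _ ≤ (#Q + (L + 1) + z * T) * (#Q + (L + 1) + z * T) ^ L := by
          rw [← sum_mul]
          gcongr
          calc ∑ t : Fin T, (if t ∈ Q then 1 else z)
              ≤ ∑ t : Fin T, ((if t ∈ Q then 1 else 0) + z) := by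
                gcongr with t; split_ifs <;> linarith
            _ = #Q + z * T := by simp [sum_add_distrib, mul_comm]
            _ ≤ _ := by linarith [(Nat.cast_nonneg L : (0:ℝ) ≤ L)]
      _ = _ := by push_cast; ring

/-- Bound on the number of families of columns whose members contained in `P` cover `W`. -/
theorem card_filter_cover_le {J : Type*} [Fintype J] [DecidableEq J] {L T : ℕ} {s : ℝ} (hs : 1 ≤ s)
    {W P : Finset (Fin T)} (hWP : W ⊆ P) :
    (#{Y : J → Fin L → Fin T | ∀ t ∈ W, ∃ j, (∀ l, Y j l ∈ P) ∧ ∃ l, Y j l = t} : ℝ) ≤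
      s⁻¹ ^ #W *
        ((T : ℝ) ^ L + ((#P + (s - 1) * #W) ^ L - (#P : ℝ) ^ L)) ^ Fintype.card J := by
  set h : (Fin L → Fin T) → ℝ := fun y =>
    if ∀ l, y l ∈ P then s ^ #{l | y l ∈ W} else 1 with hh
  have hpos : 0 < s := by linarith
  have hh0 (y) : 0 ≤ h y := by
    simp only [hh]; split_ifs <;> positivity
  have hsum : ∑ y, h y = (T : ℝ) ^ L + ((#P + (s - 1) * #W) ^ L - (#P : ℝ) ^ L) := by
    have h1 (y) : h y = 1 + if ∀ l, y l ∈ P then (∏ l, if y l ∈ W then s else 1) - 1 else 0 := by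
      simp only [hh]
      split_ifs
      · simp [prod_ite]
      · simp
    have h2 : ({y | ∀ l, y l ∈ P} : Finset (Fin L → Fin T)) = Fintype.piFinset fun _ => P := by
      ext; simp
    have h3 : ∑ t ∈ P, (if t ∈ W then s else 1) = #P + (s - 1) * #W := by
      calc _ = ∑ t ∈ P, (1 + if t ∈ W then s - 1 else 0) := by
            congr! 1 with t; split_ifs <;> ring
        _ = _ := by
            rw [sum_add_distrib, ← sum_filter, filter_mem_eq_inter, inter_eq_right.2 hWP]
            simp only [sum_const, nsmul_eq_mul]
            ring
    simp only [h1, sum_add_distrib, ← sum_filter, h2, sum_sub_distrib,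
      ← prod_univ_sum (fun _ : Fin L => P) (fun _ t => if t ∈ W then s else 1), h3]
    simp
  rw [← hsum]
  have hprod : (∑ y, h y) ^ Fintype.card J = ∑ Y : J → Fin L → Fin T, ∏ j, h (Y j) := by
    simpa using prod_univ_sum (fun _ : J => univ) fun _ => h
  rw [hprod, mul_sum, card_filter, Nat.cast_sum]
  refine sum_le_sum fun Y _ => ?_
  split_ifs with hY
  · have hle : #W ≤ ∑ j, if ∀ l, Y j l ∈ P then #{l | Y j l ∈ W} else 0 := by
      have hsub : W ⊆ univ.biUnion fun j =>
          if ∀ l, Y j l ∈ P then ({l | Y j l ∈ W} : Finset _).image (Y j) else ∅ := by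
        intro t ht
        obtain ⟨j, hj, l, rfl⟩ := hY t ht
        simp only [mem_biUnion, mem_univ, true_and]
        exact ⟨j, by rw [if_pos hj]; exact mem_image_of_mem _ (by simpa using ht)⟩
      refine (card_le_card hsub).trans (card_biUnion_le.trans (sum_le_sum fun j _ => ?_))
      split_ifs
      · exact card_image_le
      · simp
    have hpr : ∏ j, h (Y j) = s ^ ∑ j, if ∀ l, Y j l ∈ P then #{l | Y j l ∈ W} else 0 := by
      rw [← prod_pow_eq_pow_sum]
      congr! 1 with j
      simp only [hh]
      split_ifs <;> simp
    rw [hpr, inv_pow, Nat.cast_one, ← div_eq_inv_mul, one_le_div (by positivity)]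
    exact pow_le_pow_right₀ hs hle
  · have := prod_nonneg fun j (_ : j ∈ univ) => hh0 (Y j)
    simp only [Nat.cast_zero]
    positivity

/-- The tests used by a family of columns. -/
def occupied {J : Type*} [Fintype J] {L T : ℕ} (x : J → Fin L → Fin T) : Finset (Fin T) :=
  {t | ∃ j l, x j l = t}

theorem mem_occupied {J : Type*} [Fintype J] {L T : ℕ} {x : J → Fin L → Fin T} {t : Fin T} :
    t ∈ occupied x ↔ ∃ j l, x j l = t := by
  simp [occupied]

/-- Second-moment bound for the number of unoccupied tests. -/
theorem sum_sq_card_compl_occupied_sub_le (J : Type*) [Fintype J] [DecidableEq J] (L : ℕ) {T : ℕ}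
    (hT : 2 ≤ T) :
    ∑ x : J → Fin L → Fin T,
        ((#(occupied x)ᶜ : ℝ) - T * (1 - 1 / (T : ℝ)) ^ (L * Fintype.card J)) ^ 2 ≤
      T * (T : ℝ) ^ (L * Fintype.card J) := by
  set m := L * Fintype.card J
  have hT0 : (0 : ℝ) < T := by positivity
  have hcount (A : Finset (Fin T)) :
      ∑ x : J → Fin L → Fin T, (if ∀ j l, x j l ∈ A then (1 : ℝ) else 0) = (#A : ℝ) ^ m := by
    have : ({x | ∀ j l, x j l ∈ A} : Finset (J → Fin L → Fin T)) =
        Fintype.piFinset fun _ => Fintype.piFinset fun _ => A := by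
      ext; simp
    rw [sum_boole, this, Fintype.card_piFinset]
    simp [m, pow_mul]
  have hU (x : J → Fin L → Fin T) :
      (#(occupied x)ᶜ : ℝ) = ∑ t, if ∀ j l, x j l ∈ ({t}ᶜ : Finset (Fin T)) then (1 : ℝ) else 0 := by
    rw [sum_boole]
    congr 2
    ext t
    simp [mem_occupied]
  have h1 : ∑ x : J → Fin L → Fin T, (#(occupied x)ᶜ : ℝ) = T * (T - 1 : ℝ) ^ m := by
    simp only [hU]
    rw [sum_comm]
    simp only [hcount, card_compl, card_singleton, Fintype.card_fin]
    simp [Nat.cast_sub (by omega : 1 ≤ T)]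
  have h2 : ∑ x : J → Fin L → Fin T, (#(occupied x)ᶜ : ℝ) ^ 2 ≤
      T * (T : ℝ) ^ m + T ^ 2 * (T - 2 : ℝ) ^ m := by
    have hsq (x : J → Fin L → Fin T) : (#(occupied x)ᶜ : ℝ) ^ 2 =
        ∑ t, ∑ u, if ∀ j l, x j l ∈ ({t, u}ᶜ : Finset (Fin T)) then (1 : ℝ) else 0 := by
      rw [hU, sq, sum_mul_sum]
      congr! 2 with t _ u
      simp only [mem_compl, mem_singleton, mem_insert, not_or, forall_and]
      split_ifs <;> simp_all
    simp only [hsq]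
    rw [sum_comm]
    have hin (t u : Fin T) : (#({t, u}ᶜ : Finset (Fin T)) : ℝ) ^ m ≤
        (if t = u then (T : ℝ) ^ m else 0) + (T - 2 : ℝ) ^ m := by
      have hT2 : (0 : ℝ) ≤ T - 2 := by
        have : (2 : ℝ) ≤ T := by exact_mod_cast hT
        linarith
      split_ifs with htu
      · have : (#({t, u}ᶜ : Finset (Fin T)) : ℝ) ≤ T := by
          exact_mod_cast (card_le_univ _).trans (by simp)
        have := pow_le_pow_left₀ (by positivity) this m
        have := pow_nonneg hT2 m
        linarith
      · rw [card_compl, card_pair htu, Fintype.card_fin, Nat.cast_sub hT]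
        simp
    calc _ = ∑ t : Fin T, ∑ u : Fin T, (#({t, u}ᶜ : Finset (Fin T)) : ℝ) ^ m := by
          refine sum_congr rfl fun t _ => ?_
          rw [sum_comm]
          simp only [hcount]
      _ ≤ ∑ t : Fin T, ∑ u : Fin T, ((if t = u then (T : ℝ) ^ m else 0) + (T - 2 : ℝ) ^ m) :=
          sum_le_sum fun t _ => sum_le_sum fun u _ => hin t u
      _ = _ := by simp [sum_add_distrib]; ring
  set μ : ℝ := T * (1 - 1 / (T : ℝ)) ^ m
  have hμ : T * (T - 1 : ℝ) ^ m = μ * T ^ m := by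
    simp only [μ]
    rw [mul_assoc, ← mul_pow]
    congr 2
    field_simp
  have hμ2 : (T : ℝ) ^ 2 * (T - 2 : ℝ) ^ m ≤ μ ^ 2 * T ^ m := by
    have : μ ^ 2 * T ^ m = T ^ 2 * ((T : ℝ) * (1 - 1 / T) ^ 2) ^ m := by
      simp only [μ]; rw [mul_pow, mul_pow, ← pow_mul, ← pow_mul, mul_comm m 2]; ring
    rw [this]
    have h2T : (2 : ℝ) ≤ T := by exact_mod_cast hT
    gcongr
    · have : (T : ℝ) * (1 - 1 / T) ^ 2 = T - 2 + 1 / T := by field_simp; ring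
      rw [this]
      have : 0 ≤ 1 / (T : ℝ) := by positivity
      linarith
  have hcard : ∑ x : J → Fin L → Fin T, (1 : ℝ) = (T : ℝ) ^ m := by
    simp [m, pow_mul]
  calc _ = ∑ x : J → Fin L → Fin T, (#(occupied x)ᶜ : ℝ) ^ 2
        - 2 * μ * ∑ x : J → Fin L → Fin T, (#(occupied x)ᶜ : ℝ)
        + μ ^ 2 * ∑ x : J → Fin L → Fin T, (1 : ℝ) := by
        simp only [mul_sum, ← sum_sub_distrib, ← sum_add_distrib]
        congr! 1 with x
        ring
    _ ≤ _ := by rw [h1, hcard, hμ]; nlinarith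

theorem sum_ite_card_occupied_le {J : Type*} [Fintype J] [DecidableEq J] {L T : ℕ} {z c : ℝ}
    (hz : 0 ≤ z) (hc : 0 ≤ c) (i : J) :
    (T : ℝ) ^ L * ∑ x : J → Fin L → Fin T, (if (#(occupied x) : ℝ) ≤ c then
        z ^ #(univ.image (x i) \ occupied fun j : {j // j ≠ i} => x j) else 0) ≤
      (c + L + z * T) ^ L * (T ^ L : ℝ) ^ Fintype.card J := by
  rw [← (Equiv.funSplitAt i (Fin L → Fin T)).symm.sum_comp, Fintype.sum_prod_type_right]
  have hw (w : {j // j ≠ i} → Fin L → Fin T) :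
      ∑ y : Fin L → Fin T, (if (#(occupied ((Equiv.funSplitAt i _).symm (y, w))) : ℝ) ≤ c then
        z ^ #(univ.image ((Equiv.funSplitAt i _).symm (y, w) i) \
          occupied fun j : {j // j ≠ i} => (Equiv.funSplitAt i _).symm (y, w) j) else 0) ≤
      (c + L + z * T) ^ L := by
    have hres (y : Fin L → Fin T) :
        (fun j : {j // j ≠ i} => (Equiv.funSplitAt i _).symm (y, w) j) = w := by
      ext j l
      simp [Equiv.funSplitAt_symm_apply, j.2]
    have hsub (y : Fin L → Fin T) :
        occupied w ⊆ occupied ((Equiv.funSplitAt i _).symm (y, w)) := by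
      intro t ht
      obtain ⟨j, l, rfl⟩ := mem_occupied.1 ht
      exact mem_occupied.2 ⟨j, l, by simp [Equiv.funSplitAt_symm_apply, j.2]⟩
    simp only [hres]
    by_cases hwc : (#(occupied w) : ℝ) ≤ c
    · calc _ ≤ ∑ y : Fin L → Fin T, z ^ #(univ.image y \ occupied w) := by
            gcongr with y
            simp only [Equiv.funSplitAt_symm_apply, dif_pos]
            split_ifs
            · exact le_rfl
            · positivity
        _ ≤ _ := (sum_pow_card_image_sdiff_le hz L _).trans (by gcongr)
    · rw [sum_eq_zero]
      · positivity
      · intro y _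
        rw [if_neg]
        contrapose! hwc
        exact le_trans (by exact_mod_cast card_le_card (hsub y)) hwc
  calc _ ≤ (T : ℝ) ^ L * ∑ _w : {j // j ≠ i} → Fin L → Fin T, (c + L + z * T) ^ L := by
        gcongr with w; exact hw w
    _ = _ := by
        have : Fintype.card J = Fintype.card {j // j ≠ i} + 1 := by
          rw [Fintype.card_subtype_compl]
          have := Fintype.card_pos_iff.2 ⟨i⟩
          simp; omega
        rw [this]
        simp only [sum_const, card_univ, Fintype.card_pi, prod_const, Fintype.card_fin, nsmul_eq_mul]
        push_cast
        ring
theorem exists_forall_exists_of_not_ddSucceeds {N T L : ℕ} {S : Finset (Fin N)}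
    {X : Fin N → Fin L → Fin T} (h : ¬ DDSucceeds S X) :
    ∃ i ∈ S, ∀ l, ∃ j, j ≠ i ∧ j ∈ PossibleDefectives S X ∧ ∃ l', X j l' = X i l := by
  contrapose! h
  refine Set.Subset.antisymm ?_ fun i hi => ?_
  · rintro i ⟨l, ⟨j, hjS, l', hjl⟩, hl⟩
    by_contra hi
    refine hl j ?_ (fun l'' => ⟨j, hjS, l'', rfl⟩) l' hjl
    rintro rfl
    exact hi hjS
  · obtain ⟨l, hl⟩ := h i hi
    exact ⟨l, ⟨i, hi, l, rfl⟩, hl⟩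

theorem sum_pi_eq_sum_sum_subtype {ι β : Type*} [Fintype ι] [DecidableEq ι] [Fintype β]
    (p : ι → Prop) [DecidablePred p] [Fintype {i // p i}] [Fintype {i // ¬ p i}]
    (F : ({i // p i} → β) → ({i // ¬ p i} → β) → ℝ) :
    ∑ X : ι → β, F (fun i => X i) (fun i => X i) = ∑ u, ∑ v, F u v := by
  rw [← Fintype.sum_prod_type', ← (Equiv.piEquivPiSubtypeProd p fun _ => β).sum_comp]
  simp [Equiv.piEquivPiSubtypeProd]

theorem pow_add_sub_pow_le {p w s c : ℝ} {L : ℕ} (hp : 0 ≤ p) (hw : 0 ≤ w) (hwL : w ≤ L)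
    (hs : 1 ≤ s) (hpc : p ≤ c) :
    (p + (s - 1) * w) ^ L - p ^ L ≤ s * L ^ 2 * (c + s * L) ^ (L - 1) := by
  have hsw : 0 ≤ (s - 1) * w := mul_nonneg (by linarith) hw
  have hsL : (s - 1) * w ≤ s * L := by gcongr; linarith
  have h := (le_abs_self _).trans (abs_pow_sub_pow_le (p + (s - 1) * w) p L)
  rw [add_sub_cancel_left, abs_of_nonneg hsw, abs_of_nonneg (by positivity), abs_of_nonneg hp,
    max_eq_left (by linarith)] at h
  calc _ ≤ _ := h
    _ ≤ (s * L) * L * (c + s * L) ^ (L - 1) := by gcongr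
    _ = _ := by ring

theorem card_filter_undecoded_le {N T L : ℕ} {S : Finset (Fin N)} {i : Fin N} (hi : i ∈ S)
    {s c : ℝ} (hs : 1 ≤ s) (hc : 0 ≤ c) :
    (T : ℝ) ^ L * (#{X : Fin N → Fin L → Fin T |
        (#(occupied fun j : {j // j ∈ S} => X j) : ℝ) ≤ c ∧
          ∀ l, ∃ j, j ≠ i ∧ (∀ l', X j l' ∈ occupied fun j : {j // j ∈ S} => X j) ∧
            ∃ l', X j l' = X i l} : ℝ) ≤
      ((T : ℝ) ^ L + s * L ^ 2 * (c + s * L) ^ (L - 1)) ^ (N - #S) *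
        ((c + L + s⁻¹ * T) ^ L * (T ^ L : ℝ) ^ #S) := by
  set D : ℝ := (T : ℝ) ^ L + s * L ^ 2 * (c + s * L) ^ (L - 1)
  have hs0 : 0 < s := by linarith
  have hD : 0 ≤ D := by positivity
  let W (u : {j // j ∈ S} → Fin L → Fin T) : Finset (Fin T) :=
    univ.image (u ⟨i, hi⟩) \ occupied fun j : {j : {j // j ∈ S} // j ≠ ⟨i, hi⟩} => u j
  let F (u : {j // j ∈ S} → Fin L → Fin T) (v : {j // j ∉ S} → Fin L → Fin T) : ℝ :=
    if (#(occupied u) : ℝ) ≤ c ∧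
      ∀ t ∈ W u, ∃ j, (∀ l, v j l ∈ occupied u) ∧ ∃ l, v j l = t then 1 else 0
  have hF (u) : ∑ v, F u v ≤
      D ^ (N - #S) * if (#(occupied u) : ℝ) ≤ c then s⁻¹ ^ #(W u) else 0 := by
    simp only [F]
    split_ifs with hu
    · simp only [hu, true_and, sum_boole]
      have hWu : W u ⊆ occupied u := fun t ht => by
        obtain ⟨l, -, rfl⟩ := mem_image.1 (mem_sdiff.1 ht).1
        exact mem_occupied.2 ⟨_, l, rfl⟩
      have hWL : #(W u) ≤ L := by
        refine (card_le_card sdiff_subset).trans (card_image_le.trans ?_)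
        simp
      refine (card_filter_cover_le hs hWu).trans ?_
      have hcard : Fintype.card {j // j ∉ S} = N - #S := by
        rw [Fintype.card_subtype_compl]; simp
      rw [hcard, mul_comm]
      gcongr
      · have : (#(occupied u) : ℝ) ^ L ≤ (T : ℝ) ^ L := by
          gcongr
          exact_mod_cast (card_le_univ _).trans (by simp)
        have : 0 ≤ (#(occupied u) + (s - 1) * #(W u)) ^ L :=
          pow_nonneg (add_nonneg (by positivity) (mul_nonneg (by linarith) (by positivity))) _
        linarith
      · exact add_le_add le_rfl
          (pow_add_sub_pow_le (by positivity) (by positivity) (Nat.cast_le.2 hWL) hs hu)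
    · simp [hu]
  have hle : (#{X : Fin N → Fin L → Fin T |
        (#(occupied fun j : {j // j ∈ S} => X j) : ℝ) ≤ c ∧
          ∀ l, ∃ j, j ≠ i ∧ (∀ l', X j l' ∈ occupied fun j : {j // j ∈ S} => X j) ∧
            ∃ l', X j l' = X i l} : ℝ) ≤ ∑ u, ∑ v, F u v := by
    have hsplit : ∑ X : Fin N → Fin L → Fin T, F (fun i => X i) (fun i => X i) =
        ∑ u, ∑ v, F u v := sum_pi_eq_sum_sum_subtype (· ∈ S) F
    rw [← hsplit, ← sum_boole]
    refine sum_le_sum fun X _ => ?_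
    simp only [F]
    split_ifs with h1 h2
    · exact le_rfl
    · refine absurd ⟨h1.1, fun t ht => ?_⟩ h2
      obtain ⟨htX, hto⟩ := mem_sdiff.1 ht
      obtain ⟨l, -, rfl⟩ := mem_image.1 htX
      obtain ⟨j, hji, hj, l', hl'⟩ := h1.2 l
      have hjS : j ∉ S := fun hjS => hto <| mem_occupied.2
        ⟨⟨⟨j, hjS⟩, fun h => hji (congrArg Subtype.val h)⟩, l', hl'⟩
      exact ⟨⟨j, hjS⟩, hj, l', hl'⟩
    · exact zero_le_one
    · exact le_rfl
  have hsum := sum_ite_card_occupied_le (L := L) (T := T) (inv_nonneg.2 hs0.le) hc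
    (⟨i, hi⟩ : {j // j ∈ S})
  rw [Fintype.card_coe] at hsum
  calc _ ≤ (T : ℝ) ^ L *
        ∑ u, D ^ (N - #S) * if (#(occupied u) : ℝ) ≤ c then s⁻¹ ^ #(W u) else 0 := by
        gcongr
        exact hle.trans (sum_le_sum fun u _ => hF u)
    _ = D ^ (N - #S) * ((T : ℝ) ^ L *
        ∑ u, if (#(occupied u) : ℝ) ≤ c then s⁻¹ ^ #(W u) else 0) := by
        rw [← mul_sum]; ring
    _ ≤ _ := mul_le_mul_of_nonneg_left hsum (by positivity)

theorem card_filter_lt_card_occupied_le {N T L : ℕ} (S : Finset (Fin N)) (hT : 2 ≤ T) {c d : ℝ}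
    (hd : 0 < d) (hcd : T + d ≤ c + T * (1 - 1 / (T : ℝ)) ^ (L * #S)) :
    (#{X : Fin N → Fin L → Fin T | c < #(occupied fun j : {j // j ∈ S} => X j)} : ℝ) ≤
      T / d ^ 2 * (T ^ L : ℝ) ^ N := by
  have hcheb := sum_sq_card_compl_occupied_sub_le {j // j ∈ S} L hT
  rw [Fintype.card_coe] at hcheb
  set μ : ℝ := T * (1 - 1 / (T : ℝ)) ^ (L * #S)
  have hsplit := sum_pi_eq_sum_sum_subtype (β := Fin L → Fin T) (· ∈ S)
    fun u _ => if c < #(occupied u) then 1 else 0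
  rw [← sum_boole, hsplit]
  have hu (u : {j // j ∈ S} → Fin L → Fin T) :
      (if c < #(occupied u) then (1 : ℝ) else 0) ≤ ((#(occupied u)ᶜ : ℝ) - μ) ^ 2 / d ^ 2 := by
    split_ifs with h
    · rw [one_le_div (by positivity), sq_le_sq, abs_of_pos hd]
      refine le_abs.2 (Or.inr ?_)
      have : (#(occupied u)ᶜ : ℝ) + #(occupied u) = T := by
        exact_mod_cast (card_compl_add_card _).trans (Fintype.card_fin T)
      linarith
    · positivity
  have hcard : Fintype.card {j // j ∉ S} = N - #S := by
    rw [Fintype.card_subtype_compl]; simp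
  have hSN : #S ≤ N := by simpa using card_le_univ S
  calc _ = ∑ u : {j // j ∈ S} → Fin L → Fin T,
        (T ^ L : ℝ) ^ (N - #S) * (if c < #(occupied u) then (1 : ℝ) else 0) := by
        simp only [sum_const, card_univ, Fintype.card_pi, prod_const, Fintype.card_fin, hcard]
        simp
    _ ≤ (T ^ L : ℝ) ^ (N - #S) * ((T * (T : ℝ) ^ (L * #S)) / d ^ 2) := by
        rw [← mul_sum]
        gcongr
        refine (sum_le_sum fun u _ => hu u).trans ?_
        rw [← sum_div]
        gcongr
    _ = _ := by
        rw [pow_mul _ L #S, ← pow_sub_mul_pow ((T : ℝ) ^ L) hSN]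
        ring

theorem card_filter_not_ddSucceeds_le {N T L : ℕ} (S : Finset (Fin N)) (hT : 2 ≤ T) {s c d : ℝ}
    (hs : 1 ≤ s) (hc : 0 ≤ c) (hd : 0 < d)
    (hcd : T + d ≤ c + T * (1 - 1 / (T : ℝ)) ^ (L * #S))
    [DecidablePred fun X : Fin N → Fin L → Fin T => ¬ DDSucceeds S X] :
    (#{X : Fin N → Fin L → Fin T | ¬ DDSucceeds S X} : ℝ) ≤
      (T / d ^ 2 + #S * ((1 + s * L ^ 2 * (c + s * L) ^ (L - 1) / T ^ L) ^ (N - #S) *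
        ((c + L + s⁻¹ * T) / T) ^ L)) * (T ^ L : ℝ) ^ N := by
  have hT0 : (0 : ℝ) < T := by positivity
  have hSN : #S ≤ N := by simpa using card_le_univ S
  set A : Finset (Fin N → Fin L → Fin T) :=
    {X | c < #(occupied fun j : {j // j ∈ S} => X j)}
  set B : Fin N → Finset (Fin N → Fin L → Fin T) := fun i =>
    {X | (#(occupied fun j : {j // j ∈ S} => X j) : ℝ) ≤ c ∧
      ∀ l, ∃ j, j ≠ i ∧ (∀ l', X j l' ∈ occupied fun j : {j // j ∈ S} => X j) ∧
        ∃ l', X j l' = X i l}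
  have hsub : ({X : Fin N → Fin L → Fin T | ¬ DDSucceeds S X} : Finset _) ⊆
      A ∪ S.biUnion B := by
    intro X hX
    obtain ⟨i, hi, h⟩ := exists_forall_exists_of_not_ddSucceeds (mem_filter.1 hX).2
    by_cases hXc : c < #(occupied fun j : {j // j ∈ S} => X j)
    · exact mem_union_left _ (by simpa [A] using hXc)
    · refine mem_union_right _ (mem_biUnion.2 ⟨i, hi, ?_⟩)
      refine mem_filter.2 ⟨mem_univ _, not_lt.1 hXc, fun l => ?_⟩
      obtain ⟨j, hji, hj, hl⟩ := h l
      refine ⟨j, hji, fun l' => ?_, hl⟩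
      obtain ⟨k, hk, l'', hkl⟩ := hj l'
      exact mem_occupied.2 ⟨⟨k, hk⟩, l'', hkl⟩
  have hB (i) (hi : i ∈ S) : (#(B i) : ℝ) ≤
      ((1 + s * L ^ 2 * (c + s * L) ^ (L - 1) / T ^ L) ^ (N - #S) *
        ((c + L + s⁻¹ * T) / T) ^ L) * (T ^ L : ℝ) ^ N := by
    have h := card_filter_undecoded_le (L := L) (T := T) hi hs hc
    refine le_of_mul_le_mul_left (h.trans (le_of_eq ?_)) (by positivity : (0 : ℝ) < T ^ L)
    have h1 : (T : ℝ) ^ L + s * L ^ 2 * (c + s * L) ^ (L - 1) =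
        (1 + s * L ^ 2 * (c + s * L) ^ (L - 1) / T ^ L) * T ^ L := by
      field_simp
    rw [h1, mul_pow, div_pow, ← pow_sub_mul_pow ((T : ℝ) ^ L) hSN]
    field_simp
  calc (#{X : Fin N → Fin L → Fin T | ¬ DDSucceeds S X} : ℝ)
      ≤ (#A : ℝ) + ∑ i ∈ S, (#(B i) : ℝ) := by
        exact_mod_cast (card_le_card hsub).trans
          ((card_union_le _ _).trans (Nat.add_le_add_left card_biUnion_le _))
    _ ≤ T / d ^ 2 * (T ^ L : ℝ) ^ N + ∑ _i ∈ S,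
        ((1 + s * L ^ 2 * (c + s * L) ^ (L - 1) / T ^ L) ^ (N - #S) *
          ((c + L + s⁻¹ * T) / T) ^ L) * (T ^ L : ℝ) ^ N :=
        add_le_add (card_filter_lt_card_occupied_le S hT hd hcd) (sum_le_sum hB)
    _ = _ := by
        rw [sum_const, nsmul_eq_mul]; ring

theorem one_sub_le_ddSuccessProb {N K T L : ℕ} (hK : K ≤ N) (hT : 2 ≤ T) {s c d : ℝ}
    (hs : 1 ≤ s) (hc : 0 ≤ c) (hd : 0 < d)
    (hcd : T + d ≤ c + T * (1 - 1 / (T : ℝ)) ^ (L * K)) :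
    1 - (T / d ^ 2 + K * ((1 + s * L ^ 2 * (c + s * L) ^ (L - 1) / T ^ L) ^ (N - K) *
        ((c + L + s⁻¹ * T) / T) ^ L)) ≤ ddSuccessProb N K T L := by
  classical
  set δ : ℝ := T / d ^ 2 + K * ((1 + s * L ^ 2 * (c + s * L) ^ (L - 1) / T ^ L) ^ (N - K) *
    ((c + L + s⁻¹ * T) / T) ^ L)
  have hT0 : (0 : ℝ) < T := by positivity
  have htot : (Nat.card ({S : Finset (Fin N) // S.card = K} × (Fin N → Fin L → Fin T)) : ℝ) =
      N.choose K * (T ^ L : ℝ) ^ N := by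
    simp [Nat.card_eq_fintype_card]
  have hpos : (0 : ℝ) < N.choose K * (T ^ L : ℝ) ^ N := by
    have : (0 : ℝ) < N.choose K := by exact_mod_cast Nat.choose_pos hK
    positivity
  have hsucc : (Nat.card {ω : {S : Finset (Fin N) // S.card = K} × (Fin N → Fin L → Fin T) //
      DDSucceeds ω.1.1 ω.2} : ℝ) = ∑ S : {S : Finset (Fin N) // S.card = K},
        (#{X : Fin N → Fin L → Fin T | DDSucceeds S.1 X} : ℝ) := by
    rw [Nat.card_eq_fintype_card, Fintype.card_subtype, ← sum_boole, Fintype.sum_prod_type]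
    simp
  have hS (S : {S : Finset (Fin N) // S.card = K}) :
      (1 - δ) * (T ^ L : ℝ) ^ N ≤ #{X : Fin N → Fin L → Fin T | DDSucceeds S.1 X} := by
    have h := card_filter_not_ddSucceeds_le S.1 hT hs hc hd (by rw [S.2]; exact hcd)
    rw [S.2] at h
    have hadd : (#{X : Fin N → Fin L → Fin T | DDSucceeds S.1 X} : ℝ) +
        #{X : Fin N → Fin L → Fin T | ¬ DDSucceeds S.1 X} = (T ^ L : ℝ) ^ N := by
      have := card_filter_add_card_filter_not (s := (univ : Finset (Fin N → Fin L → Fin T)))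
        (DDSucceeds S.1)
      rw [card_univ] at this
      simp only [Fintype.card_pi, prod_const, Fintype.card_fin, card_univ] at this
      exact_mod_cast this
    simp only [δ]
    linarith
  rw [ddSuccessProb, htot, hsucc, le_div_iff₀ hpos]
  calc (1 - δ) * (N.choose K * (T ^ L : ℝ) ^ N)
      = ∑ _S : {S : Finset (Fin N) // S.card = K}, (1 - δ) * (T ^ L : ℝ) ^ N := by
        rw [sum_const, card_univ, Fintype.card_finset_len, Fintype.card_fin, nsmul_eq_mul]
        ring
    _ ≤ _ := sum_le_sum fun S _ => hS S

theorem ddSuccessProb_le_one (N K T L : ℕ) : ddSuccessProb N K T L ≤ 1 := by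
  refine div_le_one_of_le₀ ?_ (Nat.cast_nonneg _)
  exact_mod_cast Nat.card_le_card_of_injective Subtype.val Subtype.val_injective

end Counting

theorem tendsto_mul_pow_of_logb_le {ι : Type*} {l : Filter ι} {x : ι → ℝ} {L : ι → ℕ} {A r : ℝ}
    (hr0 : 0 < r) (hr1 : r ≤ 1) (hA : A * Real.logb 2 r < -1) (hx : Tendsto x l atTop)
    (hL : ∀ᶠ n in l, A * Real.logb 2 (x n) ≤ L n + 1) :
    Tendsto (fun n => x n * r ^ L n) l (nhds 0) := by
  have hlim : Tendsto (fun n => r⁻¹ * x n ^ (-(-1 - A * Real.logb 2 r))) l (nhds 0) := by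
    have hexp : 0 < -1 - A * Real.logb 2 r := by linarith
    simpa only [mul_zero, Function.comp_def] using
      ((tendsto_rpow_neg_atTop hexp).comp hx).const_mul r⁻¹
  refine squeeze_zero' ?_ ?_ hlim
  · filter_upwards [hx.eventually_ge_atTop 0] with n hn
    positivity
  · filter_upwards [hL, hx.eventually_gt_atTop 0] with n hn hxn
    have hpow : r ^ (A * Real.logb 2 (x n)) = x n ^ (A * Real.logb 2 r) := by
      rw [Real.rpow_def_of_pos hr0, Real.rpow_def_of_pos hxn, Real.logb, Real.logb]
      ring_nf
    calc x n * r ^ L n = r⁻¹ * (x n * r ^ (L n + 1)) := by rw [pow_succ]; field_simp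
      _ ≤ r⁻¹ * (x n * x n ^ (A * Real.logb 2 r)) := by
          gcongr
          rw [← hpow, ← Real.rpow_natCast]
          refine Real.rpow_le_rpow_of_exponent_ge hr0 hr1 ?_
          push_cast
          exact hn
      _ = _ := by
          rw [← Real.rpow_one_add' hxn.le (by linarith)]
          congr 2
          ring

theorem eventually_lt_one_sub_inv_pow {ι : Type*} {l : Filter ι} {T m : ι → ℕ} {α q : ℝ}
    (hq : q < Real.exp (-α)) (hT : Tendsto T l atTop)
    (hm : ∀ᶠ n in l, (m n : ℝ) ≤ α * T n) :
    ∀ᶠ n in l, q < (1 - 1 / (T n : ℝ)) ^ m n := by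
  have hlim : Tendsto (fun n => ((1 + -1 / (T n : ℝ)) ^ T n) ^ α) l (nhds (Real.exp (-α))) := by
    have := ((Real.tendsto_one_add_div_pow_exp (-1)).comp hT).rpow_const (p := α)
      (Or.inl (Real.exp_pos _).ne')
    rwa [← Real.exp_mul, neg_one_mul] at this
  filter_upwards [hlim.eventually_const_lt hq, hm, hT.eventually_ge_atTop 2] with n hn hmn hTn
  have hT2 : (2 : ℝ) ≤ T n := by exact_mod_cast hTn
  have hinv : 1 / (T n : ℝ) ≤ 1 / 2 := by gcongr
  have hinv0 : 0 ≤ 1 / (T n : ℝ) := by positivity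
  refine hn.trans_le ?_
  rw [neg_div, ← sub_eq_add_neg, ← Real.rpow_natCast, ← Real.rpow_natCast,
    ← Real.rpow_mul (by linarith)]
  exact Real.rpow_le_rpow_of_exponent_ge (by linarith) (by linarith) (by linarith)

theorem mul_one_add_pow_mul_pow_le {N K L T : ℕ} {q s r : ℝ} (hq : 0 ≤ q) (hs : 0 ≤ s)
    (hL : 1 ≤ L) (hK : 0 < K) (hT : 0 < T) (hLK : (L * K : ℝ) ≤ Real.log 2 * T)
    (hqr : q + s * (L / T) ≤ r)
    (hexp : (q + L / T + s⁻¹) * Real.exp (s * Real.log 2 * (N / K * r ^ (L - 1))) ≤ r) :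
    (K : ℝ) * ((1 + s * L ^ 2 * (q * T + s * L) ^ (L - 1) / T ^ L) ^ (N - K) *
      ((q * T + L + s⁻¹ * T) / T) ^ L) ≤ K * r ^ L := by
  have hT0 : (0 : ℝ) < T := by positivity
  have hK0 : (0 : ℝ) < K := by positivity
  have hr : 0 ≤ r := le_trans (by positivity) hqr
  have hbase : (q * T + L + s⁻¹ * T) / T = q + L / T + s⁻¹ := by field_simp
  have hinc : s * L ^ 2 * (q * T + s * L) ^ (L - 1) / T ^ L ≤
      L * (s * Real.log 2 * (1 / K * r ^ (L - 1))) := by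
    have hmul : q * T + s * L = (q + s * (L / T)) * T := by field_simp
    have hTL : (T : ℝ) ^ L = T ^ (L - 1) * T := by rw [← pow_succ, Nat.sub_add_cancel hL]
    calc _ = s * L * (L / T) * (q + s * (L / T)) ^ (L - 1) := by
          rw [hmul, mul_pow, hTL]; field_simp
      _ ≤ s * L * (Real.log 2 / K) * r ^ (L - 1) := by
          have : (L : ℝ) / T ≤ Real.log 2 / K := by
            rw [div_le_div_iff₀ hT0 hK0]; exact hLK
          gcongr
      _ = _ := by ring
  have hpow : (1 + s * L ^ 2 * (q * T + s * L) ^ (L - 1) / T ^ L) ^ (N - K) ≤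
      Real.exp (s * Real.log 2 * (N / K * r ^ (L - 1))) ^ L := by
    calc _ ≤ Real.exp (L * (s * Real.log 2 * (1 / K * r ^ (L - 1)))) ^ (N - K) := by
          gcongr
          rw [add_comm]
          exact (Real.add_one_le_exp _).trans (Real.exp_le_exp.2 hinc)
      _ ≤ Real.exp (L * (s * Real.log 2 * (1 / K * r ^ (L - 1)))) ^ N := by
          have : 0 ≤ Real.log 2 := Real.log_nonneg (by norm_num)
          gcongr
          · exact Real.one_le_exp (by positivity)
          · exact Nat.sub_le N K
      _ = _ := by
          rw [← Real.exp_nat_mul, ← Real.exp_nat_mul]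
          congr 1
          ring
  rw [hbase]
  gcongr
  calc _ ≤ Real.exp (s * Real.log 2 * (N / K * r ^ (L - 1))) ^ L * (q + L / T + s⁻¹) ^ L := by
        gcongr
    _ = ((q + L / T + s⁻¹) * Real.exp (s * Real.log 2 * (N / K * r ^ (L - 1)))) ^ L := by
        rw [mul_pow, mul_comm]
    _ ≤ _ := by gcongr

theorem tendsto_ddSuccessProb {K T L : ℕ → ℕ} {ε : ℝ} (hε : 0 < ε)
    (hK : Tendsto K atTop atTop) (hNK : Tendsto (fun N : ℕ => (N : ℝ) / K N) atTop atTop)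
    (hT : Tendsto T atTop atTop) (hLT : ∀ᶠ N in atTop, (L N * K N : ℝ) ≤ Real.log 2 * T N)
    (hL₁ : ∀ᶠ N in atTop, (1 + ε) * Real.logb 2 (N / K N) ≤ L N + 1)
    (hL₂ : ∀ᶠ N in atTop, (1 + ε) * Real.logb 2 (K N) ≤ L N + 1) :
    Tendsto (fun N => ddSuccessProb N (K N) (T N) (L N)) atTop (nhds 1) := by
  have hlog2 : 0 < Real.log 2 := Real.log_pos (by norm_num)
  obtain ⟨γ, hγ, hγε⟩ : ∃ γ : ℝ, 0 < γ ∧ 1 / 2 + 3 * γ < 2 ^ (-(1 / (1 + ε))) := by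
    have h : (1 / 2 : ℝ) < 2 ^ (-(1 / (1 + ε))) := by
      rw [one_div, ← Real.rpow_neg_one]
      refine Real.rpow_lt_rpow_of_exponent_lt (by norm_num) (neg_lt_neg ?_)
      rw [div_lt_one (by linarith)]
      linarith
    exact ⟨(2 ^ (-(1 / (1 + ε))) - 1 / 2) / 6, by linarith, by linarith⟩
  set r : ℝ := 1 / 2 + 3 * γ
  have hr0 : 0 < r := by positivity
  have hr1 : r ≤ 1 :=
    hγε.le.trans (Real.rpow_le_one_of_one_le_of_nonpos (by norm_num) (by
      rw [neg_nonpos]; positivity))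
  have hlogr : (1 + ε) * Real.logb 2 r < -1 := by
    have h := (Real.logb_lt_iff_lt_rpow (by norm_num) hr0).2 hγε
    calc (1 + ε) * Real.logb 2 r < (1 + ε) * -(1 / (1 + ε)) := by gcongr
      _ = -1 := by field_simp
  have hKR : Tendsto (fun N => (K N : ℝ)) atTop atTop := tendsto_natCast_atTop_atTop.comp hK
  have hTR : Tendsto (fun N => (T N : ℝ)) atTop atTop := tendsto_natCast_atTop_atTop.comp hT
  have hKr := tendsto_mul_pow_of_logb_le hr0 hr1 hlogr hKR hL₂
  have hNr := tendsto_mul_pow_of_logb_le hr0 hr1 hlogr hNK hL₁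
  have hL : ∀ᶠ N in atTop, 1 ≤ L N := by
    have hlim : Tendsto (fun N => (1 + ε) * Real.logb 2 (K N)) atTop atTop :=
      ((Real.tendsto_logb_atTop (by norm_num)).comp hKR).const_mul_atTop (by linarith)
    filter_upwards [hL₂, hlim.eventually_gt_atTop 1] with N h1 h2
    have : (0 : ℝ) < L N := by linarith
    exact_mod_cast this
  have hNr' : Tendsto (fun N : ℕ => (N : ℝ) / K N * r ^ (L N - 1)) atTop (nhds 0) := by
    have h := hNr.const_mul r⁻¹
    rw [mul_zero] at h
    refine h.congr' ?_
    filter_upwards [hL] with N hN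
    obtain ⟨k, hk⟩ := Nat.exists_eq_add_of_le' hN
    rw [hk, Nat.add_sub_cancel, pow_succ]
    field_simp
  have hratio : Tendsto (fun N => (L N : ℝ) / T N) atTop (nhds 0) := by
    refine squeeze_zero' (Eventually.of_forall fun N => by positivity) ?_
      (hKR.const_div_atTop (Real.log 2))
    filter_upwards [hLT, hKR.eventually_gt_atTop 0, hTR.eventually_gt_atTop 0] with N h1 h2 h3
    rw [div_le_div_iff₀ h3 h2]
    exact h1
  have hqr : ∀ᶠ N in atTop, 1 / 2 + γ + γ⁻¹ * ((L N : ℝ) / T N) ≤ r := by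
    have h := (hratio.const_mul γ⁻¹).const_add (1 / 2 + γ)
    exact h.eventually_le_const (by simp only [r]; linarith)
  have hexp : ∀ᶠ N in atTop, (1 / 2 + γ + (L N : ℝ) / T N + γ⁻¹⁻¹) *
      Real.exp (γ⁻¹ * Real.log 2 * (N / K N * r ^ (L N - 1))) ≤ r := by
    have h := ((hratio.const_add (1 / 2 + γ)).add_const γ⁻¹⁻¹).mul
      ((Real.continuous_exp.tendsto _).comp (hNr'.const_mul (γ⁻¹ * Real.log 2)))
    refine h.eventually_le_const ?_
    rw [mul_zero, Real.exp_zero, inv_inv]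
    simp only [r]
    linarith
  have hempty : ∀ᶠ N in atTop, 1 / 2 - γ / 2 < (1 - 1 / (T N : ℝ)) ^ (L N * K N) := by
    refine eventually_lt_one_sub_inv_pow (α := Real.log 2) ?_ hT ?_
    · rw [Real.exp_neg, Real.exp_log (by norm_num)]
      linarith
    · filter_upwards [hLT] with N hN
      exact_mod_cast hN
  have hlim : Tendsto (fun N => 1 - (4 / γ ^ 2 / T N + K N * r ^ L N)) atTop (nhds 1) := by
    simpa using ((hTR.const_div_atTop (4 / γ ^ 2)).add hKr).const_sub 1
  refine tendsto_of_tendsto_of_tendsto_of_le_of_le' hlim tendsto_const_nhds ?_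
    (Eventually.of_forall fun N => ddSuccessProb_le_one _ _ _ _)
  filter_upwards [hLT, hL, hqr, hexp, hempty, hK.eventually_gt_atTop 0, hT.eventually_ge_atTop 2,
    hNK.eventually_ge_atTop 1] with N hLTN hLN hqrN hexpN hemptyN hKN hTN hNKN
  have hT0 : (0 : ℝ) < T N := by positivity
  have hKN' : K N ≤ N := by
    have hK0 : (0 : ℝ) < K N := by exact_mod_cast hKN
    rw [one_le_div hK0] at hNKN
    exact_mod_cast hNKN
  have hγ1 : 1 ≤ γ⁻¹ := (one_le_inv₀ hγ).2 (by simp only [r] at hr1; linarith)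
  have hbound := one_sub_le_ddSuccessProb (L := L N) hKN' hTN hγ1
    (c := (1 / 2 + γ) * T N) (d := γ / 2 * T N) (by positivity) (by positivity) (by nlinarith)
  have herr := mul_one_add_pow_mul_pow_le (by positivity) (by positivity) hLN hKN (by omega) hLTN
    hqrN hexpN
  have hvar : (T N : ℝ) / (γ / 2 * T N) ^ 2 = 4 / γ ^ 2 / T N := by
    field_simp
    norm_num
  rw [hvar] at hbound
  linarith

/-- DD achievability for near-constant column weight designs:
if `K = Θ(N^θ)` with `θ ∈ (0,1)` and
`T ≥ (1+ε)·(1/ln 2)·max{K·log₂(N/K), K·log₂ K}`, then with per-item weight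
`L = ⌊(ln 2)·T/K⌋` the DD success probability tends to `1`. -/
theorem dd_success_tendsto_one
    (θ ε a b : ℝ) (hθ0 : 0 < θ) (hθ1 : θ < 1) (hε : 0 < ε) (ha : 0 < a) (hab : a ≤ b)
    (K T : ℕ → ℕ)
    (hK : ∀ N : ℕ, a * (N : ℝ) ^ θ ≤ (K N : ℝ) ∧ (K N : ℝ) ≤ b * (N : ℝ) ^ θ)
    (hT : ∀ N : ℕ, (T N : ℝ) ≥ (1 + ε) * (1 / Real.log 2) *
      max ((K N : ℝ) * Real.logb 2 ((N : ℝ) / (K N : ℝ))) ((K N : ℝ) * Real.logb 2 (K N))) :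
    Tendsto (fun N => ddSuccessProb N (K N) (T N) ⌊Real.log 2 * (T N : ℝ) / (K N : ℝ)⌋₊)
      atTop (nhds 1) := by
  have hKR : Tendsto (fun N => (K N : ℝ)) atTop atTop :=
    tendsto_atTop_mono (fun N => (hK N).1)
      (((tendsto_rpow_atTop hθ0).comp tendsto_natCast_atTop_atTop).const_mul_atTop ha)
  have hK0 : ∀ᶠ N in atTop, (0 : ℝ) < K N := hKR.eventually_gt_atTop 0
  have hb : 0 < b := ha.trans_le hab
  have hNK : Tendsto (fun N : ℕ => (N : ℝ) / K N) atTop atTop := by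
    refine tendsto_atTop_mono' _ ?_ (((tendsto_rpow_atTop (sub_pos.2 hθ1)).comp
      tendsto_natCast_atTop_atTop).const_mul_atTop (inv_pos.2 hb))
    filter_upwards [hK0, eventually_gt_atTop 0] with N hKN hN
    have hN0 : (0 : ℝ) < N := by exact_mod_cast hN
    calc b⁻¹ * (N : ℝ) ^ (1 - θ) = N / (b * (N : ℝ) ^ θ) := by
          rw [Real.rpow_sub hN0, Real.rpow_one]; field_simp
      _ ≤ _ := by
          gcongr
          exact (hK N).2
  have hlog2 : 0 < Real.log 2 := Real.log_pos (by norm_num)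
  have hrate : ∀ᶠ N in atTop, (1 + ε) * max (Real.logb 2 (N / K N)) (Real.logb 2 (K N)) ≤
      Real.log 2 * (T N : ℝ) / K N := by
    filter_upwards [hK0] with N hKN
    rw [le_div_iff₀ hKN]
    have h := mul_le_mul_of_nonneg_left (hT N) hlog2.le
    rw [← mul_max_of_nonneg _ _ hKN.le] at h
    refine le_trans (le_of_eq ?_) h
    field_simp
  have hfloor : ∀ᶠ N in atTop,
      (1 + ε) * max (Real.logb 2 (N / K N)) (Real.logb 2 (K N)) ≤
        ⌊Real.log 2 * (T N : ℝ) / (K N : ℝ)⌋₊ + 1 := by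
    filter_upwards [hrate] with N hN
    exact hN.trans (Nat.lt_floor_add_one _).le
  have hTR : Tendsto (fun N => (T N : ℝ)) atTop atTop := by
    have hlim : Tendsto (fun N => (1 + ε) * Real.logb 2 (K N)) atTop atTop :=
      ((Real.tendsto_logb_atTop (by norm_num)).comp hKR).const_mul_atTop (by linarith)
    refine tendsto_atTop_mono' _ ?_ hKR
    filter_upwards [hrate, hK0, hlim.eventually_ge_atTop (Real.log 2)] with N h1 h2 h3
    have h4 : Real.log 2 ≤ Real.log 2 * (T N : ℝ) / K N :=
      h3.trans (le_trans (by gcongr; exact le_max_right _ _) h1)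
    rw [le_div_iff₀ h2] at h4
    exact le_of_mul_le_mul_left h4 hlog2
  refine tendsto_ddSuccessProb hε (tendsto_natCast_atTop_iff.1 hKR) hNK
    (tendsto_natCast_atTop_iff.1 hTR) ?_ ?_ ?_
  · filter_upwards [hK0] with N hKN
    rw [← le_div_iff₀ hKN]
    exact Nat.floor_le (by positivity)
  · filter_upwards [hfloor] with N hN
    exact le_trans (by gcongr; exact le_max_left _ _) hN
  · filter_upwards [hfloor] with N hN
    exact le_trans (by gcongr; exact le_max_right _ _) hN
end
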